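/- Under the path measure μ_n conditioned on the event {ω_n = free}, with r = 1 − a − b, the variance of the occupation time of the free state equals [a·b·(2−a−b)/(a+b)³ + 2·b·(a−b)·rⁿ/(a+b)³]·n + [b·(3a−b)/(a+b)³ − 4·a·b/(a+b)⁴]·(1 − rⁿ) + (b²/(a+b)⁴)·(1 − r²ⁿ). -/

import Mathlib

open Finset

/-- Transition probabilities of the two-state Markov chain on `{free, adsorbed}`,
with `true` = free and `false` = adsorbed: `p(free→free)=1−b`, `p(free→adsorbed)=b`,
`p(adsorbed→free)=a`, `p(adsorbed→adsorbed)=1−a`. -/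
noncomputable def transP (a b : ℝ) : Bool → Bool → ℝ
  | true, true => 1 - b
  | true, false => b
  | false, true => a
  | false, false => 1 - a

/-- Stationary initial distribution: `π(free)=a/(a+b)`, `π(adsorbed)=b/(a+b)`. -/
noncomputable def statDist (a b : ℝ) : Bool → ℝ
  | true => a / (a + b)
  | false => b / (a + b)

/-- The path measure `μ_n(ω) = π(ω₀) · ∏_{k=0}^{n−1} p(ω_k → ω_{k+1})` on paths
`ω : {0,…,n} → {free, adsorbed}`. -/
noncomputable def pathMeasure (a b : ℝ) (n : ℕ) (ω : Fin (n + 1) → Bool) : ℝ :=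
  statDist a b (ω 0) * ∏ k : Fin n, transP a b (ω k.castSucc) (ω k.succ)

/-- The occupation time `K_n(ω) = #{k ∈ {1,…,n} : ω_k = free}` of the free state. -/
def occTime (n : ℕ) (ω : Fin (n + 1) → Bool) : ℕ :=
  (Finset.univ.filter fun k : Fin (n + 1) => 1 ≤ (k : ℕ) ∧ ω k = true).card

/-- The set of paths that are in the free state at time `n`. -/
def freeAtEnd (n : ℕ) : Finset (Fin (n + 1) → Bool) :=
  Finset.univ.filter fun ω => ω (Fin.last n) = true

/-- The expectation of `f K_n` on the event that the chain is in state `c` at time `n`. -/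
noncomputable def endExpect (a b : ℝ) (n : ℕ) (f : ℕ → ℝ) (c : Bool) : ℝ :=
  ∑ ω : Fin (n + 1) → Bool, if ω (Fin.last n) = c then pathMeasure a b n ω * f (occTime n ω) else 0

theorem sum_freeAtEnd (a b : ℝ) (n : ℕ) (f : ℕ → ℝ) :
    ∑ ω ∈ freeAtEnd n, pathMeasure a b n ω * f (occTime n ω) = endExpect a b n f true := by
  rw [freeAtEnd, endExpect, Finset.sum_filter]

theorem pathMeasure_snoc (a b : ℝ) (n : ℕ) (ω : Fin (n + 1) → Bool) (c : Bool) :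
    pathMeasure a b (n + 1) (Fin.snoc ω c : Fin (n + 2) → Bool)
      = pathMeasure a b n ω * transP a b (ω (Fin.last n)) c := by
  have h0 : (Fin.snoc ω c : Fin (n + 2) → Bool) 0 = ω 0 :=
    Fin.snoc_castSucc (α := fun _ => Bool) c ω 0
  unfold pathMeasure
  rw [Fin.prod_univ_castSucc, h0]
  simp only [Fin.succ_castSucc, Fin.succ_last, Fin.snoc_castSucc, Fin.snoc_last]
  ring

theorem occTime_snoc (n : ℕ) (ω : Fin (n + 1) → Bool) (c : Bool) :
    occTime (n + 1) (Fin.snoc ω c : Fin (n + 2) → Bool)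
      = occTime n ω + if c = true then 1 else 0 := by
  unfold occTime
  rw [Finset.card_filter, Finset.card_filter, Fin.sum_univ_castSucc]
  simp

theorem endExpect_succ (a b : ℝ) (n : ℕ) (f : ℕ → ℝ) (c : Bool) :
    endExpect a b (n + 1) f c
      = ∑ d, transP a b d c * endExpect a b n (fun k => f (k + if c = true then 1 else 0)) d := by
  unfold endExpect
  rw [← (Fin.snocEquiv (fun _ : Fin (n + 2) => Bool)).sum_comp, Fintype.sum_prod_type]
  simp only [Fin.snocEquiv_apply, Fin.snoc_last, Finset.mul_sum]
  rw [Finset.sum_eq_single c (fun d _ hd => by simp [hd]) (by simp), Finset.sum_comm]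
  refine Finset.sum_congr rfl fun ω _ => ?_
  rw [Finset.sum_eq_single (ω (Fin.last n)) (fun d _ hd => by simp [hd.symm]) (by simp)]
  have hsnoc : Fin.snocEquiv (fun _ : Fin (n + 2) => Bool) (c, ω)
      = (Fin.snoc ω c : Fin (n + 2) → Bool) := rfl
  simp only [if_true, hsnoc, pathMeasure_snoc, occTime_snoc]
  ring

theorem endExpect_add (a b : ℝ) (n : ℕ) (f g : ℕ → ℝ) (c : Bool) :
    endExpect a b n (fun k => f k + g k) c = endExpect a b n f c + endExpect a b n g c := by
  unfold endExpect
  rw [← Finset.sum_add_distrib]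
  refine Finset.sum_congr rfl fun ω _ => ?_
  split_ifs <;> ring

theorem endExpect_const_mul (a b : ℝ) (n : ℕ) (x : ℝ) (f : ℕ → ℝ) (c : Bool) :
    endExpect a b n (fun k => x * f k) c = x * endExpect a b n f c := by
  unfold endExpect
  rw [Finset.mul_sum]
  refine Finset.sum_congr rfl fun ω _ => ?_
  split_ifs <;> ring

theorem endExpect_zero (a b : ℝ) (f : ℕ → ℝ) (c : Bool) :
    endExpect a b 0 f c = statDist a b c * f 0 := by
  have h : ∀ ω : Fin 1 → Bool, occTime 0 ω = 0 := fun ω => by simp [occTime]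
  unfold endExpect
  rw [← (Equiv.funUnique (Fin 1) Bool).symm.sum_comp]
  simp [pathMeasure, h]

/-- The mass of each end state is its stationary probability. -/
theorem endExpect_one (a b : ℝ) (h : a + b ≠ 0) (n : ℕ) (c : Bool) :
    endExpect a b n (fun _ => 1) c = statDist a b c := by
  induction n generalizing c with
  | zero => simp [endExpect_zero]
  | succ n ih =>
    rw [endExpect_succ]
    simp only [ih]
    cases c <;> simp [transP, statDist] <;> field_simp <;> ring

/-- The first moments of the occupation time on each end state. -/
theorem endExpect_id (a b : ℝ) (h : a + b ≠ 0) (n : ℕ) :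
    endExpect a b n (fun k => (k : ℝ)) true
        = a / (a + b) * (a / (a + b) * n + b / (a + b) ^ 2 * (1 - (1 - a - b) ^ n)) ∧
      endExpect a b n (fun k => (k : ℝ)) false
        = a * b / (a + b) ^ 2 * (n - (1 - (1 - a - b) ^ n) / (a + b)) := by
  induction n with
  | zero => simp [endExpect_zero]
  | succ n ih =>
    simp only [endExpect_succ, Fintype.sum_bool, transP, if_true, Bool.false_eq_true, if_false,
      add_zero, Nat.cast_add, Nat.cast_one, endExpect_add, endExpect_one a b h, ih.1, ih.2,
      statDist, pow_succ]
    generalize (1 - a - b) ^ n = R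
    constructor <;> field_simp <;> ring

/-- The claimed conditional variance, with `R` standing for `(1 - a - b) ^ n`. -/
noncomputable def varFormula (a b n R : ℝ) : ℝ :=
  (a * b * (2 - a - b) / (a + b) ^ 3 + 2 * b * (a - b) * R / (a + b) ^ 3) * n
    + (b * (3 * a - b) / (a + b) ^ 3 - 4 * a * b / (a + b) ^ 4) * (1 - R)
    + (b ^ 2 / (a + b) ^ 4) * (1 - R ^ 2)

/-- The second moment of the occupation time on the free end state, and its total over both
end states. -/
theorem endExpect_sq (a b : ℝ) (h : a + b ≠ 0) (n : ℕ) :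
    endExpect a b n (fun k => (k : ℝ) ^ 2) true
        = a / (a + b) * (varFormula a b n ((1 - a - b) ^ n)
          + (a / (a + b) * n + b / (a + b) ^ 2 * (1 - (1 - a - b) ^ n)) ^ 2) ∧
      endExpect a b n (fun k => (k : ℝ) ^ 2) true + endExpect a b n (fun k => (k : ℝ) ^ 2) false
        = a ^ 2 / (a + b) ^ 2 * (n * (n + 1))
          + 2 * a * b / (a + b) ^ 3 * (n - (1 - a - b) * (1 - (1 - a - b) ^ n) / (a + b))
          - a / (a + b) * n := by
  induction n with
  | zero => simp [endExpect_zero, varFormula]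
  | succ n ih =>
    have hF := eq_sub_of_add_eq' ih.2
    rw [ih.1] at hF
    have hsq : ∀ k : ℕ, ((k : ℝ) + 1) ^ 2 = (k : ℝ) ^ 2 + (2 * (k : ℝ) + 1) := fun k => by ring
    simp only [endExpect_succ, Fintype.sum_bool, transP, if_true, Bool.false_eq_true, if_false,
      add_zero, Nat.cast_add, Nat.cast_one, hsq, endExpect_add, endExpect_const_mul,
      endExpect_one a b h, (endExpect_id a b h n).1, (endExpect_id a b h n).2, ih.1, hF,
      statDist, pow_succ (1 - a - b), varFormula]
    generalize (1 - a - b) ^ n = R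
    constructor <;> field_simp <;> ring

/-- Under the path measure `μ_n` conditioned on the event `{ω_n = free}`,
with `r = 1 − a − b`, the variance of the occupation time of the free state equals
`[a·b·(2−a−b)/(a+b)³ + 2·b·(a−b)·rⁿ/(a+b)³]·n
  + [b·(3a−b)/(a+b)³ − 4·a·b/(a+b)⁴]·(1 − rⁿ) + (b²/(a+b)⁴)·(1 − r²ⁿ)`. -/
theorem stmt5 (a b : ℝ) (ha : a ∈ Set.Ioo (0 : ℝ) 1) (hb : b ∈ Set.Ioo (0 : ℝ) 1)
    (n : ℕ) (r : ℝ) (hr : r = 1 - a - b) :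
    (∑ ω ∈ freeAtEnd n, pathMeasure a b n ω *
        ((occTime n ω : ℝ)
          - (∑ ω' ∈ freeAtEnd n, pathMeasure a b n ω' * (occTime n ω' : ℝ)) /
            (∑ ω' ∈ freeAtEnd n, pathMeasure a b n ω')) ^ 2) /
      (∑ ω ∈ freeAtEnd n, pathMeasure a b n ω)
      = (a * b * (2 - a - b) / (a + b) ^ 3
            + 2 * b * (a - b) * r ^ n / (a + b) ^ 3) * n
        + (b * (3 * a - b) / (a + b) ^ 3 - 4 * a * b / (a + b) ^ 4) * (1 - r ^ n)
        + (b ^ 2 / (a + b) ^ 4) * (1 - r ^ (2 * n)) := by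
  have h : a + b ≠ 0 := (add_pos ha.1 hb.1).ne'
  have ha0 : a ≠ 0 := ha.1.ne'
  have hmass : ∑ ω ∈ freeAtEnd n, pathMeasure a b n ω = a / (a + b) := by
    simpa [endExpect_one a b h, statDist] using sum_freeAtEnd a b n (fun _ => 1)
  have hquad : ∀ m : ℝ, ∑ ω ∈ freeAtEnd n, pathMeasure a b n ω * ((occTime n ω : ℝ) - m) ^ 2
      = endExpect a b n (fun k => (k : ℝ) ^ 2) true
        + (-(2 * m) * endExpect a b n (fun k => (k : ℝ)) true + m ^ 2 * (a / (a + b))) := by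
    intro m
    have hexp : (fun k : ℕ => ((k : ℝ) - m) ^ 2)
        = fun k : ℕ => (k : ℝ) ^ 2 + (-(2 * m) * (k : ℝ) + m ^ 2 * 1) := by
      funext k
      ring
    rw [sum_freeAtEnd a b n (fun k => ((k : ℝ) - m) ^ 2), hexp]
    simp only [endExpect_add, endExpect_const_mul a b n (-(2 * m)) (fun k => (k : ℝ)),
      endExpect_const_mul a b n (m ^ 2) (fun _ => 1), endExpect_one a b h, statDist]
  rw [hquad, hmass, sum_freeAtEnd a b n (fun k => (k : ℝ)), (endExpect_id a b h n).1,
    (endExpect_sq a b h n).1, hr, mul_comm 2 n, pow_mul, varFormula]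
  generalize (1 - a - b) ^ n = R
  field_simp
  ring
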